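/- arXiv:1709.04567 — 2 statements merged into one kernel-verified Lean document; each statement's English description precedes it below -/
import Mathlib

section
/- Let A = {x ∈ 3^ω : ∀n, x(n) ≠ x(n+1)}. There is a continuous function P : [2^ω]³_{E_0} → A such that for every E_0-tree map Φ, P[[range Φ]³_{E_0}] = A. Moreover, if Φ_p, Φ_q, Φ_r are E_0-tree maps whose stems have equal length and which have identical blocks (v_n^i), then the image under P of range(Φ_p) ×_{E_0} range(Φ_q) ×_{E_0} range(Φ_r) meets every E_0-class of A, where E_0 on 3^ω is the eventual-agreement equivalence relation. -/
open Set Function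

/-- The eventual-agreement equivalence relation `E₀` (on `2^ω` or `3^ω`). -/
def E0 {α : Type*} (x y : ℕ → α) : Prop := ∃ n, ∀ k > n, x k = y k

/-- The finite initial segment `s ⌢ v 0 (x 0) ⌢ ⋯ ⌢ v (n-1) (x (n-1))`. -/
def blockPrefix (s : List Bool) (v : ℕ → Bool → List Bool) (x : ℕ → Bool) : ℕ → List Bool
  | 0 => s
  | n + 1 => blockPrefix s v x n ++ v n (x n)

/-- The map `x ↦ s ⌢ v 0 (x 0) ⌢ v 1 (x 1) ⌢ ⋯` determined by a stem `s` and blocks `v`. -/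
def e0TreeMapOf (s : List Bool) (v : ℕ → Bool → List Bool) (x : ℕ → Bool) : ℕ → Bool :=
  fun m => (blockPrefix s v x (m + 1)).getD m false

/-- Conditions on the blocks of an `E₀`-tree. -/
def IsE0Blocks (v : ℕ → Bool → List Bool) : Prop :=
  (∀ n i, (v n i).head? = some i) ∧ ∀ n, (v n false).length = (v n true).length

/-- `Φ` is an `E₀`-tree map. -/
def IsE0TreeMap (Φ : (ℕ → Bool) → (ℕ → Bool)) : Prop :=
  ∃ s v, IsE0Blocks v ∧ Φ = e0TreeMapOf s v

/-- `A₀ ×_{E₀} A₁ ×_{E₀} A₂`: triples with `xᵢ ∈ Aᵢ`, pairwise `E₀`-inequivalent. -/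
def prodE0 (A0 A1 A2 : Set (ℕ → Bool)) : Set ((ℕ → Bool) × (ℕ → Bool) × (ℕ → Bool)) :=
  {p | p.1 ∈ A0 ∧ p.2.1 ∈ A1 ∧ p.2.2 ∈ A2 ∧
    ¬E0 p.1 p.2.1 ∧ ¬E0 p.1 p.2.2 ∧ ¬E0 p.2.1 p.2.2}

/-- `[B]³_{E₀}`: triples from `B` that are pairwise `E₀`-inequivalent. -/
def triplesE0 (B : Set (ℕ → Bool)) : Set ((ℕ → Bool) × (ℕ → Bool) × (ℕ → Bool)) :=
  prodE0 B B B

/-- `A = {x ∈ 3^ω : ∀ n, x n ≠ x (n+1)}`. -/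
def A3 : Set (ℕ → Fin 3) := {x | ∀ n, x n ≠ x (n + 1)}

open Filter Topology

/-- One step of the collapsing automaton: the state holds the number of letters emitted so far
and the last emitted letter. -/
def collapseStep (s : ℕ × Option (Fin 3)) (o : Option (Fin 3)) : ℕ × Option (Fin 3) :=
  if o = none ∨ o = s.2 then s else (s.1 + 1, o)

/-- The state of the collapsing automaton after reading the first `n` entries of `e`. -/
def collapseState (e : ℕ → Option (Fin 3)) : ℕ → ℕ × Option (Fin 3)
  | 0 => (0, none)
  | n + 1 => collapseStep (collapseState e n) (e n)

/-- The sequence of letters of `e`, with blanks and consecutive repetitions removed. -/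
noncomputable def collapse (e : ℕ → Option (Fin 3)) (k : ℕ) : Fin 3 :=
  (collapseState e (sInf {n | (collapseState e n).1 = k + 1})).2.getD 0

/-- The index of the entry differing from the two others, if there is one. -/
def oddOne (a b c : Bool) : Option (Fin 3) :=
  if a = b then (if b = c then none else some 2) else if a = c then some 1 else some 0

/-- The sequence of odd ones out of a triple of binary sequences. -/
def oddSeq (p : (ℕ → Bool) × (ℕ → Bool) × (ℕ → Bool)) (n : ℕ) : Option (Fin 3) :=
  oddOne (p.1 n) (p.2.1 n) (p.2.2 n)

theorem collapseStep_eq_or (s : ℕ × Option (Fin 3)) (o : Option (Fin 3)) :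
    collapseStep s o = s ∨ (o ≠ none ∧ o ≠ s.2 ∧ collapseStep s o = (s.1 + 1, o)) := by
  unfold collapseStep
  split_ifs with h
  · exact Or.inl rfl
  · push Not at h
    exact Or.inr ⟨h.1, h.2, rfl⟩

theorem collapseStep_of_blank {s : ℕ × Option (Fin 3)} {o : Option (Fin 3)}
    (h : o = none ∨ o = s.2) : collapseStep s o = s := if_pos h

theorem collapseStep_of_ne {s : ℕ × Option (Fin 3)} {o : Option (Fin 3)}
    (h : o ≠ none) (h' : o ≠ s.2) : collapseStep s o = (s.1 + 1, o) :=
  if_neg (by tauto)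

theorem collapseState_le_or_eq (e : ℕ → Option (Fin 3)) (n d : ℕ) :
    collapseState e (n + d) = collapseState e n ∨
      (collapseState e n).1 < (collapseState e (n + d)).1 := by
  induction d with
  | zero => exact Or.inl rfl
  | succ d ih =>
    rw [← add_assoc, collapseState]
    rcases collapseStep_eq_or (collapseState e (n + d)) (e (n + d)) with h | ⟨-, -, h⟩
    · rwa [h]
    · rw [h]
      rcases ih with h | h
      · right; simp [h]
      · right; exact Nat.lt_succ_of_lt h

theorem collapseState_eq_of_fst_eq {e : ℕ → Option (Fin 3)} {n n' : ℕ}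
    (h : (collapseState e n).1 = (collapseState e n').1) :
    collapseState e n = collapseState e n' := by
  wlog hle : n ≤ n' generalizing n n'
  · exact (this h.symm (by omega)).symm
  obtain ⟨d, rfl⟩ := Nat.exists_eq_add_of_le hle
  rcases collapseState_le_or_eq e n d with h' | h'
  · exact h'.symm
  · omega

theorem collapse_eq_getD {e : ℕ → Option (Fin 3)} {n k : ℕ}
    (h : (collapseState e n).1 = k + 1) : collapse e k = (collapseState e n).2.getD 0 := by
  have h' : (collapseState e (sInf {n | (collapseState e n).1 = k + 1})).1 = k + 1 :=
    Nat.sInf_mem (s := {n | (collapseState e n).1 = k + 1}) ⟨n, h⟩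
  rw [collapse, collapseState_eq_of_fst_eq (h'.trans h.symm)]

theorem collapseState_congr {e e' : ℕ → Option (Fin 3)} {n : ℕ} (h : ∀ i < n, e i = e' i) :
    collapseState e n = collapseState e' n := by
  induction n with
  | zero => rfl
  | succ n ih =>
    rw [collapseState, collapseState, ih fun i hi => h i (by omega), h n n.lt_succ_self]

theorem collapseState_of_blanks {e : ℕ → Option (Fin 3)} {n d : ℕ}
    (h : ∀ i < d, e (n + i) = none ∨ e (n + i) = (collapseState e n).2) :
    collapseState e (n + d) = collapseState e n := by
  induction d with
  | zero => rfl
  | succ d ih =>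
    rw [← add_assoc, collapseState, ih fun i hi => h i (by omega),
      collapseStep_of_blank (h d d.lt_succ_self)]

/-- `e` never becomes eventually constant up to blanks. -/
def Alternating (e : ℕ → Option (Fin 3)) : Prop :=
  ∀ c : Option (Fin 3), ∀ n, ∃ m ≥ n, e m ≠ none ∧ e m ≠ c

theorem Alternating.exists_fst_eq {e : ℕ → Option (Fin 3)} (he : Alternating e) (k : ℕ) :
    ∃ n, (collapseState e n).1 = k ∧ (collapseState e (n + 1)).1 = k + 1 := by
  have key : ∀ n, ∃ m, (collapseState e m).1 = (collapseState e n).1 ∧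
      (collapseState e (m + 1)).1 = (collapseState e n).1 + 1 := by
    intro n
    obtain ⟨m, ⟨hm, h0, h1⟩, hmin⟩ := Nat.findX (he (collapseState e n).2 n)
    obtain ⟨d, rfl⟩ := Nat.exists_eq_add_of_le hm
    have hs : collapseState e (n + d) = collapseState e n := by
      refine collapseState_of_blanks fun i hi => ?_
      have := hmin (n + i) (by omega)
      by_contra hc
      push Not at hc
      exact this ⟨by omega, hc⟩
    refine ⟨n + d, by rw [hs], ?_⟩
    rw [collapseState, collapseStep_of_ne h0 (by rwa [hs]), hs]
  induction k with
  | zero => exact key 0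
  | succ k ih =>
    obtain ⟨n, -, hn⟩ := ih
    simpa [hn] using key (n + 1)

theorem collapse_mem_A3 {e : ℕ → Option (Fin 3)} (he : Alternating e) : collapse e ∈ A3 := by
  intro k
  obtain ⟨n, h0, h1⟩ := he.exists_fst_eq (k + 1)
  rw [collapse_eq_getD h0, collapse_eq_getD h1]
  obtain ⟨l, hl⟩ : ∃ l, (collapseState e n).2 = some l := by
    have : ∀ n, (collapseState e n).1 ≠ 0 → (collapseState e n).2 ≠ none := by
      intro n
      induction n with
      | zero => exact fun h => absurd rfl h
      | succ n ih =>
        rw [collapseState]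
        rcases collapseStep_eq_or (collapseState e n) (e n) with h | ⟨h, -, h'⟩
        · rwa [h]
        · rw [h']
          exact fun _ => h
    exact Option.ne_none_iff_exists'.1 (this n (by omega))
  rw [collapseState] at h1 ⊢
  rcases collapseStep_eq_or (collapseState e n) (e n) with h | ⟨h, h', h''⟩
  · rw [h] at h1; omega
  · rw [h'', hl]
    rw [hl] at h'
    obtain ⟨c, hc⟩ := Option.ne_none_iff_exists'.1 h
    rw [hc] at h' ⊢
    simpa using fun h => h' (congrArg some h.symm)

theorem alternating_oddSeq {p : (ℕ → Bool) × (ℕ → Bool) × (ℕ → Bool)}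
    (hp : p ∈ triplesE0 univ) : Alternating (oddSeq p) := by
  obtain ⟨-, -, -, h01, h02, h12⟩ := hp
  intro c n
  by_contra! H
  have H' : ∀ m > n, oddSeq p m = none ∨ oddSeq p m = c := fun m hm => by
    by_contra! hc
    exact hc.2 (H m hm.le hc.1)
  have dec : ∀ a b d : Bool, (oddOne a b d = none → a = b ∧ a = d) ∧
      (oddOne a b d = some 0 → b = d) ∧ (oddOne a b d = some 1 → a = d) ∧
      (oddOne a b d = some 2 → a = b) := by decide
  rcases c with _ | c
  · exact h01 ⟨n, fun k hk => ((dec _ _ _).1 ((H' k hk).elim id id)).1⟩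
  · fin_cases c
    · exact h12 ⟨n, fun k hk => (H' k hk).elim
        (fun h => ((dec _ _ _).1 h).1.symm.trans ((dec _ _ _).1 h).2) (dec _ _ _).2.1⟩
    · exact h02 ⟨n, fun k hk => (H' k hk).elim
        (fun h => ((dec _ _ _).1 h).2) (dec _ _ _).2.2.1⟩
    · exact h01 ⟨n, fun k hk => (H' k hk).elim
        (fun h => ((dec _ _ _).1 h).1) (dec _ _ _).2.2.2⟩

theorem eventually_collapseState_oddSeq_eq (p : (ℕ → Bool) × (ℕ → Bool) × (ℕ → Bool)) (n : ℕ) :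
    ∀ᶠ q in 𝓝 p, collapseState (oddSeq q) n = collapseState (oddSeq p) n := by
  induction n with
  | zero => exact Eventually.of_forall fun _ => rfl
  | succ n ih =>
    have hc : ∀ f : (ℕ → Bool) × (ℕ → Bool) × (ℕ → Bool) → Bool, Continuous f →
        ∀ᶠ q in 𝓝 p, f q = f p := fun f hf =>
      hf.continuousAt.eventually (p := fun c => c = f p) (by simp [nhds_discrete])
    filter_upwards [ih, hc (fun q => q.1 n) (by fun_prop), hc (fun q => q.2.1 n) (by fun_prop),
      hc (fun q => q.2.2 n) (by fun_prop)] with q h h0 h1 h2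
    rw [collapseState, collapseState, h, oddSeq, oddSeq, h0, h1, h2]

theorem continuousOn_collapse_oddSeq :
    ContinuousOn (fun p => collapse (oddSeq p)) (triplesE0 univ) := by
  refine continuousOn_pi.2 fun k p hp => ContinuousAt.continuousWithinAt ?_
  obtain ⟨n, -, hn⟩ := (alternating_oddSeq hp).exists_fst_eq k
  refine tendsto_nhds_of_eventually_eq ?_
  filter_upwards [eventually_collapseState_oddSeq_eq p (n + 1)] with q hq
  rw [collapse_eq_getD hn, collapse_eq_getD (n := n + 1) (by rw [hq, hn]), hq]

/-- The position at which the `n`-th block of an `E₀`-tree with stem length `l` begins. -/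
def blockStart (l : ℕ) (v : ℕ → Bool → List Bool) : ℕ → ℕ
  | 0 => l
  | n + 1 => blockStart l v n + (v n false).length

theorem length_block {v : ℕ → Bool → List Bool} (hv : IsE0Blocks v) (n : ℕ) (i : Bool) :
    (v n i).length = (v n false).length := by
  cases i
  · rfl
  · exact (hv.2 n).symm

theorem length_block_pos {v : ℕ → Bool → List Bool} (hv : IsE0Blocks v) (n : ℕ) :
    0 < (v n false).length :=
  List.length_pos_iff.2 fun h => by simpa [h] using hv.1 n false

theorem length_blockPrefix {s : List Bool} {v : ℕ → Bool → List Bool} (hv : IsE0Blocks v)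
    (x : ℕ → Bool) (n : ℕ) : (blockPrefix s v x n).length = blockStart s.length v n := by
  induction n with
  | zero => rfl
  | succ n ih => rw [blockPrefix, List.length_append, ih, length_block hv, blockStart]

theorem le_blockStart {v : ℕ → Bool → List Bool} (hv : IsE0Blocks v) (l n : ℕ) :
    n ≤ blockStart l v n := by
  induction n with
  | zero => exact Nat.zero_le _
  | succ n ih => have := length_block_pos hv n; rw [blockStart]; omega

theorem blockPrefix_mono (s : List Bool) (v : ℕ → Bool → List Bool) (x : ℕ → Bool) {n m : ℕ}
    (h : n ≤ m) : blockPrefix s v x n <+: blockPrefix s v x m := by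
  induction m, h using Nat.le_induction with
  | base => exact List.prefix_rfl
  | succ m _ ih => exact ih.trans (List.prefix_append _ _)

theorem e0TreeMapOf_eq_getD {s : List Bool} {v : ℕ → Bool → List Bool} (hv : IsE0Blocks v)
    (x : ℕ → Bool) {n m : ℕ} (h : m < blockStart s.length v n) :
    e0TreeMapOf s v x m = (blockPrefix s v x n).getD m false := by
  have h' : m < blockStart s.length v (m + 1) := le_blockStart hv _ (m + 1)
  have aux : ∀ {k l : ℕ}, k ≤ l → m < blockStart s.length v k →
      (blockPrefix s v x k).getD m false = (blockPrefix s v x l).getD m false := by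
    intro k l hkl hm
    obtain ⟨t, ht⟩ := blockPrefix_mono s v x hkl
    rw [← ht, List.getD_append _ _ _ _ (by rwa [length_blockPrefix hv])]
  rcases le_total (m + 1) n with hle | hle
  · exact aux hle h'
  · exact (aux hle h).symm

theorem e0TreeMapOf_stem {s : List Bool} {v : ℕ → Bool → List Bool} (hv : IsE0Blocks v)
    (x : ℕ → Bool) {m : ℕ} (h : m < s.length) : e0TreeMapOf s v x m = s.getD m false :=
  e0TreeMapOf_eq_getD hv x (n := 0) h

theorem e0TreeMapOf_block {s : List Bool} {v : ℕ → Bool → List Bool} (hv : IsE0Blocks v)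
    (x : ℕ → Bool) {n j : ℕ} (h : j < (v n false).length) :
    e0TreeMapOf s v x (blockStart s.length v n + j) = (v n (x n)).getD j false := by
  rw [e0TreeMapOf_eq_getD hv x (n := n + 1) (by rw [blockStart]; omega), blockPrefix,
    List.getD_append_right _ _ _ _ (by rw [length_blockPrefix hv]; omega),
    length_blockPrefix hv, Nat.add_sub_cancel_left]

theorem e0TreeMapOf_blockStart {s : List Bool} {v : ℕ → Bool → List Bool} (hv : IsE0Blocks v)
    (x : ℕ → Bool) (n : ℕ) : e0TreeMapOf s v x (blockStart s.length v n) = x n := by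
  have := e0TreeMapOf_block (s := s) hv x (length_block_pos hv n)
  rw [add_zero] at this
  rw [this, List.getD_eq_getElem?_getD, ← List.head?_eq_getElem?, hv.1, Option.getD_some]

/-- The characteristic sequence of `{n | b n = i}`. -/
def letterSeq (b : ℕ → Fin 3) (i : Fin 3) (n : ℕ) : Bool := decide (b n = i)

/-- The triple in the `E₀`-product of three trees whose `n`-th odd one out is `b n`. -/
def treeTriple (sp sq sr : List Bool) (v : ℕ → Bool → List Bool) (b : ℕ → Fin 3) :
    (ℕ → Bool) × (ℕ → Bool) × (ℕ → Bool) :=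
  (e0TreeMapOf sp v (letterSeq b 0), e0TreeMapOf sq v (letterSeq b 1),
    e0TreeMapOf sr v (letterSeq b 2))

section treeTriple

variable {sp sq sr : List Bool} {v : ℕ → Bool → List Bool} {b : ℕ → Fin 3}

theorem not_E0_letterSeq (hv : IsE0Blocks v) (hpq : sp.length = sq.length) (hb : b ∈ A3)
    {i j : Fin 3} (hij : i ≠ j) :
    ¬E0 (e0TreeMapOf sp v (letterSeq b i)) (e0TreeMapOf sq v (letterSeq b j)) := by
  rintro ⟨n, hn⟩
  have key : ∀ k > n, letterSeq b i k = letterSeq b j k := fun k hk => by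
    have := hn (blockStart sp.length v k) (lt_of_lt_of_le hk (le_blockStart hv _ k))
    rwa [e0TreeMapOf_blockStart hv, hpq, e0TreeMapOf_blockStart hv] at this
  have dec : ∀ i j c d : Fin 3, i ≠ j → decide (c = i) = decide (c = j) →
      decide (d = i) = decide (d = j) → c = d := by decide
  exact hb (n + 1) (dec i j _ _ hij (key _ (by omega)) (key _ (by omega)))

theorem treeTriple_mem_prodE0 (hv : IsE0Blocks v) (hpq : sp.length = sq.length)
    (hqr : sq.length = sr.length) (hb : b ∈ A3) :
    treeTriple sp sq sr v b ∈ prodE0 (range (e0TreeMapOf sp v)) (range (e0TreeMapOf sq v))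
      (range (e0TreeMapOf sr v)) :=
  ⟨mem_range_self _, mem_range_self _, mem_range_self _, not_E0_letterSeq hv hpq hb (by decide),
    not_E0_letterSeq hv (hpq.trans hqr) hb (by decide), not_E0_letterSeq hv hqr hb (by decide)⟩

theorem oddSeq_treeTriple (m : ℕ) :
    oddSeq (treeTriple sp sq sr v b) m = oddOne (e0TreeMapOf sp v (letterSeq b 0) m)
      (e0TreeMapOf sq v (letterSeq b 1) m) (e0TreeMapOf sr v (letterSeq b 2) m) := rfl

theorem oddSeq_treeTriple_stem (hv : IsE0Blocks v) (hpq : sp.length = sq.length)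
    (hqr : sq.length = sr.length) {m : ℕ} (hm : m < sp.length) :
    oddSeq (treeTriple sp sq sr v b) m =
      oddOne (sp.getD m false) (sq.getD m false) (sr.getD m false) := by
  rw [oddSeq_treeTriple, e0TreeMapOf_stem hv _ hm, e0TreeMapOf_stem hv _ (hpq ▸ hm),
    e0TreeMapOf_stem hv _ (hqr ▸ hpq ▸ hm)]

theorem oddSeq_treeTriple_blockStart (hv : IsE0Blocks v) (hpq : sp.length = sq.length)
    (hqr : sq.length = sr.length) (n : ℕ) :
    oddSeq (treeTriple sp sq sr v b) (blockStart sp.length v n) = some (b n) := by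
  have dec : ∀ c : Fin 3,
      oddOne (decide (c = 0)) (decide (c = 1)) (decide (c = 2)) = some c := by decide
  rw [oddSeq_treeTriple, e0TreeMapOf_blockStart hv, hpq, e0TreeMapOf_blockStart hv, hqr,
    e0TreeMapOf_blockStart hv]
  exact dec (b n)

theorem oddSeq_treeTriple_block (hv : IsE0Blocks v) (hpq : sp.length = sq.length)
    (hqr : sq.length = sr.length) {n j : ℕ} (hj : j < (v n false).length) :
    oddSeq (treeTriple sp sq sr v b) (blockStart sp.length v n + j) = none ∨
      oddSeq (treeTriple sp sq sr v b) (blockStart sp.length v n + j) = some (b n) := by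
  have dec : ∀ (f : Bool → Bool) (c : Fin 3),
      oddOne (f (decide (c = 0))) (f (decide (c = 1))) (f (decide (c = 2))) = none ∨
      oddOne (f (decide (c = 0))) (f (decide (c = 1))) (f (decide (c = 2))) = some c := by decide
  rw [oddSeq_treeTriple, e0TreeMapOf_block hv _ hj, hpq, e0TreeMapOf_block hv _ hj, hqr,
    e0TreeMapOf_block hv _ hj]
  exact dec (fun i => (v n i).getD j false) (b n)

theorem collapse_oddSeq_treeTriple (hv : IsE0Blocks v) (hpq : sp.length = sq.length)
    (hqr : sq.length = sr.length) (hb : b ∈ A3) {m : ℕ} {l : Option (Fin 3)}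
    (hs : collapseState (oddSeq (treeTriple sp sq sr v b)) sp.length = (m, l))
    (hl : some (b 0) ≠ l) (k : ℕ) :
    collapse (oddSeq (treeTriple sp sq sr v b)) (m + k) = b k := by
  set e := oddSeq (treeTriple sp sq sr v b) with he
  have block : ∀ n, some (b n) ≠ (collapseState e (blockStart sp.length v n)).2 →
      collapseState e (blockStart sp.length v (n + 1)) =
        ((collapseState e (blockStart sp.length v n)).1 + 1, some (b n)) := by
    intro n hn
    obtain ⟨d, hd⟩ := Nat.exists_eq_add_of_le' (length_block_pos hv n)
    have h1 : collapseState e (blockStart sp.length v n + 1) =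
        ((collapseState e (blockStart sp.length v n)).1 + 1, some (b n)) := by
      have h0 : e (blockStart sp.length v n) = some (b n) :=
        oddSeq_treeTriple_blockStart hv hpq hqr n
      rw [collapseState, h0, collapseStep_of_ne (by simp) hn]
    rw [blockStart, hd, add_comm d, ← add_assoc, ← h1]
    refine collapseState_of_blanks fun i hi => ?_
    rw [h1, add_assoc]
    exact oddSeq_treeTriple_block hv hpq hqr (by omega)
  have main : ∀ n, collapseState e (blockStart sp.length v (n + 1)) =
      (m + n + 1, some (b n)) := by
    intro n
    induction n with
    | zero =>
      have h0 : collapseState e (blockStart sp.length v 0) = (m, l) := hs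
      rw [block 0 (by rwa [h0]), h0, add_zero]
    | succ n ih =>
      rw [block (n + 1) (by rw [ih]; simpa using (hb n).symm), ih, add_assoc m]
  rw [collapse_eq_getD (n := blockStart sp.length v (k + 1)) (by rw [main]), main, Option.getD_some]

end treeTriple

/-- There is a continuous `P : [2^ω]³_{E₀} → A` whose image on `[range Φ]³_{E₀}` is all of `A`
for every `E₀`-tree map `Φ`; moreover for `E₀`-tree maps with stems of equal length and the
same blocks, the image of the corresponding `E₀`-product meets every `E₀`-class of `A`. -/
theorem exists_P_onto_A3 :
    ∃ P : (ℕ → Bool) × (ℕ → Bool) × (ℕ → Bool) → (ℕ → Fin 3),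
      ContinuousOn P (triplesE0 univ) ∧
      (∀ p ∈ triplesE0 univ, P p ∈ A3) ∧
      (∀ Φ : (ℕ → Bool) → (ℕ → Bool), IsE0TreeMap Φ →
        P '' triplesE0 (range Φ) = A3) ∧
      (∀ (sp sq sr : List Bool) (v : ℕ → Bool → List Bool), IsE0Blocks v →
        sp.length = sq.length → sq.length = sr.length →
        ∀ a ∈ A3, ∃ p ∈ prodE0 (range (e0TreeMapOf sp v)) (range (e0TreeMapOf sq v))
            (range (e0TreeMapOf sr v)), E0 (P p) a) := by
  refine ⟨fun p => collapse (oddSeq p), continuousOn_collapse_oddSeq,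
    fun p hp => collapse_mem_A3 (alternating_oddSeq hp), ?_, ?_⟩
  · rintro Φ ⟨s, v, hv, rfl⟩
    refine Subset.antisymm ?_ fun a ha => ?_
    · rintro _ ⟨p, ⟨-, -, -, hp⟩, rfl⟩
      exact collapse_mem_A3 (alternating_oddSeq ⟨mem_univ _, mem_univ _, mem_univ _, hp⟩)
    · refine ⟨treeTriple s s s v a, treeTriple_mem_prodE0 hv rfl rfl ha, funext fun k => ?_⟩
      have hs : collapseState (oddSeq (treeTriple s s s v a)) (0 + s.length) = (0, none) :=
        collapseState_of_blanks fun i hi => Or.inl <| by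
          rw [zero_add, oddSeq_treeTriple_stem hv rfl rfl hi]
          simp [oddOne]
      rw [zero_add] at hs
      simpa using collapse_oddSeq_treeTriple hv rfl rfl ha hs (by simp) k
  · intro sp sq sr v hv hpq hqr a ha
    obtain ⟨⟨m, l⟩, hml⟩ : ∃ s, ∀ b,
        collapseState (oddSeq (treeTriple sp sq sr v b)) sp.length = s :=
      ⟨_, fun b => collapseState_congr fun i hi => oddSeq_treeTriple_stem hv hpq hqr hi⟩
    obtain ⟨t, htl, hta⟩ : ∃ t : Fin 3, some t ≠ l ∧ t ≠ a (m + 1) := by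
      have dec : ∀ (l : Option (Fin 3)) (c : Fin 3), ∃ t : Fin 3, some t ≠ l ∧ t ≠ c := by decide
      exact dec l _
    let b : ℕ → Fin 3 := fun k => if k = 0 then t else a (m + k)
    have hb : b ∈ A3 := by
      rintro (_ | k)
      · simpa [b] using hta
      · simpa [b, add_assoc] using ha (m + (k + 1))
    refine ⟨treeTriple sp sq sr v b, treeTriple_mem_prodE0 hv hpq hqr hb, m, fun k hk => ?_⟩
    obtain ⟨d, rfl⟩ := Nat.exists_eq_add_of_lt hk
    rw [add_assoc m d 1]
    exact (collapse_oddSeq_treeTriple hv hpq hqr hb (hml b) htl (d + 1)).trans (by simp [b])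
end

section
/- There is a Borel function K : (2^ω)³ → 2^ω such that: (1) for every analytic set A ⊆ 2^ω admitting a Borel reduction of E_0 into E_0 ↾ A, K[[A]³_{E_0}] = 2^ω; and (2) for all analytic sets A_0, A_1, A_2 ⊆ 2^ω such that each A_i admits a Borel reduction of E_0 into E_0 ↾ A_i and [A_0]_{E_0} = [A_1]_{E_0} = [A_2]_{E_0}, the E_0-saturation of K[A_0 ×_{E_0} A_1 ×_{E_0} A_2] is all of 2^ω. -/
open Set Function

/-- The `E₀`-saturation of a set. -/
def satE0 (A : Set (ℕ → Bool)) : Set (ℕ → Bool) := {y | ∃ x ∈ A, E0 x y}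

open Filter Topology

section BaireProperty

variable {X : Type*} [TopologicalSpace X]

/-- The points at which a set is locally nonmeager. -/
def nonmeagerPoints (S : Set X) : Set X := {x | ∀ U, IsOpen U → x ∈ U → ¬IsMeagre (S ∩ U)}

theorem isClosed_nonmeagerPoints (S : Set X) : IsClosed (nonmeagerPoints S) := by
  rw [← isOpen_compl_iff, isOpen_iff_forall_mem_open]
  intro x hx
  simp only [nonmeagerPoints, mem_compl_iff, mem_ofPred_eq, not_forall, not_not] at hx
  obtain ⟨U, hU, hxU, hm⟩ := hx
  exact ⟨U, fun y hy h => h U hU hy hm, hU, hxU⟩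

theorem nonmeagerPoints_subset_closure (S : Set X) : nonmeagerPoints S ⊆ closure S := by
  intro x hx
  rw [mem_closure_iff]
  intro U hU hxU
  have := nonempty_of_not_isMeagre (hx U hU hxU)
  rwa [inter_comm]

theorem isMeagre_diff_nonmeagerPoints [SecondCountableTopology X] (S : Set X) :
    IsMeagre (S \ nonmeagerPoints S) := by
  have hB := TopologicalSpace.isBasis_countableBasis X
  have hc : {U ∈ TopologicalSpace.countableBasis X | IsMeagre (S ∩ U)}.Countable :=
    (TopologicalSpace.countable_countableBasis X).mono (sep_subset _ _)
  refine (isMeagre_biUnion hc (f := fun U => S ∩ U) fun U hU => hU.2).mono ?_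
  rintro x ⟨hxS, hx⟩
  simp only [nonmeagerPoints, mem_ofPred_eq, not_forall, not_not] at hx
  obtain ⟨U, hU, hxU, hm⟩ := hx
  obtain ⟨V, hV, hxV, hVU⟩ := hB.exists_subset_of_mem_open hxU hU
  exact mem_biUnion (x := V) ⟨hV, hm.mono (inter_subset_inter_right _ hVU)⟩ ⟨hxS, hxV⟩

theorem IsClosed.isMeagre_diff_interior {F : Set X} (hF : IsClosed F) :
    IsMeagre (F \ interior F) := by
  rw [← hF.frontier_eq]
  exact (isClosed_frontier.isNowhereDense_iff.2 (interior_frontier hF)).isMeagre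

theorem IsOpen.isMeagre_closure_diff {U : Set X} (hU : IsOpen U) :
    IsMeagre (closure U \ U) := by
  have h := hU.isClosed_compl.isMeagre_diff_interior
  rw [interior_compl] at h
  refine h.mono ?_
  rintro x ⟨hx, hxU⟩
  exact ⟨hxU, not_not.2 hx⟩

theorem isMeagre_nonmeagerPoints_diff_iUnion [SecondCountableTopology X] {ι : Type*} [Countable ι]
    {S : Set X} {T : ι → Set X} (hST : S ⊆ ⋃ i, T i) :
    IsMeagre (nonmeagerPoints S \ ⋃ i, nonmeagerPoints (T i)) := by
  set P := ⋃ i, interior (nonmeagerPoints (T i)) with hP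
  have hPo : IsOpen P := isOpen_iUnion fun _ => isOpen_interior
  have key : interior (nonmeagerPoints S) ⊆ closure P := by
    intro x hx
    by_contra hxP
    refine interior_subset hx (closure P)ᶜ isClosed_closure.isOpen_compl hxP ?_
    refine (isMeagre_iUnion fun i => (isMeagre_diff_nonmeagerPoints (T i)).union
      (isClosed_nonmeagerPoints (T i)).isMeagre_diff_interior).mono ?_
    rintro y ⟨hyS, hyP⟩
    obtain ⟨i, hi⟩ := mem_iUnion.1 (hST hyS)
    refine mem_iUnion.2 ⟨i, ?_⟩
    by_cases hy : y ∈ nonmeagerPoints (T i)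
    · exact .inr ⟨hy, fun h => hyP (subset_closure (mem_iUnion.2 ⟨i, h⟩))⟩
    · exact .inl ⟨hi, hy⟩
  refine ((isClosed_nonmeagerPoints S).isMeagre_diff_interior.union
    hPo.isMeagre_closure_diff).mono ?_
  rintro x ⟨hxS, hx⟩
  by_cases hxi : x ∈ interior (nonmeagerPoints S)
  · exact .inr ⟨key hxi, fun h => hx (iUnion_mono (fun i => interior_subset) h)⟩
  · exact .inl ⟨hxS, hxi⟩

/-- Analytic sets have the property of Baire. -/
theorem MeasureTheory.AnalyticSet.baireMeasurableSet [SecondCountableTopology X] [RegularSpace X]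
    [T2Space X] {A : Set X} (hA : MeasureTheory.AnalyticSet A) : BaireMeasurableSet A := by
  rw [MeasureTheory.AnalyticSet] at hA
  obtain rfl | ⟨g, hg, rfl⟩ := hA
  · exact isOpen_empty.baireMeasurableSet
  let T : List ℕ → Set X := fun s => g '' {y | PiNat.res y s.length = s}
  have hT : ∀ s, T s ⊆ ⋃ k, T (k :: s) := by
    rintro s _ ⟨y, hy, rfl⟩
    refine mem_iUnion.2 ⟨y s.length, y, ?_, rfl⟩
    rw [mem_ofPred_eq] at hy
    simp [PiNat.res_succ, hy]
  have hbad := isMeagre_iUnion fun s => isMeagre_nonmeagerPoints_diff_iUnion (hT s)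
  have hT0 : T [] = range g := by simp [T]
  have h2 : nonmeagerPoints (range g) \ range g ⊆
      ⋃ s, (nonmeagerPoints (T s) \ ⋃ k, nonmeagerPoints (T (k :: s))) := by
    rintro x ⟨hxH, hxg⟩
    by_contra hx
    have hstep : ∀ s, ∃ k, x ∈ nonmeagerPoints (T s) → x ∈ nonmeagerPoints (T (k :: s)) := by
      intro s
      by_cases h : x ∈ nonmeagerPoints (T s)
      · by_contra! hk
        exact hx (mem_iUnion.2 ⟨s, h, fun h' => by
          obtain ⟨k, hk'⟩ := mem_iUnion.1 h'
          exact (hk k).2 hk'⟩)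
      · exact ⟨0, fun h' => absurd h' h⟩
    choose k hk using hstep
    let s : ℕ → List ℕ := fun n => Nat.rec [] (fun _ t => k t :: t) n
    let y : ℕ → ℕ := fun n => k (s n)
    have hs : ∀ n, PiNat.res y n = s n := by
      intro n
      induction n with
      | zero => rfl
      | succ n ih => rw [PiNat.res_succ, ih]
    have hxs : ∀ n, x ∈ nonmeagerPoints (T (s n)) := by
      intro n
      induction n with
      | zero => change x ∈ nonmeagerPoints (T []); rwa [hT0]
      | succ n ih => exact hk _ ih
    apply hxg
    refine ⟨y, ?_⟩
    by_contra hne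
    obtain ⟨u, v, hu, hv, hyu, hxv, huv⟩ := t2_separation hne
    obtain ⟨_, ⟨z, n, rfl⟩, hyz, hzu⟩ :=
      (PiNat.isTopologicalBasis_cylinders (fun _ => ℕ)).exists_subset_of_mem_open
        (show y ∈ g ⁻¹' u from hyu) (hu.preimage hg)
    obtain ⟨_, hwv, w, hw, rfl⟩ :=
      mem_closure_iff.1 (nonmeagerPoints_subset_closure _ (hxs n)) v hv hxv
    rw [mem_ofPred_eq, ← hs, PiNat.res_length, ← mem_ofPred (p := fun w => PiNat.res w n = _),
      ← PiNat.cylinder_eq_res, PiNat.mem_cylinder_iff_eq, PiNat.mem_cylinder_iff_eq.1 hyz] at hw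
    exact disjoint_left.1 huv (hzu (PiNat.mem_cylinder_iff_eq.2 hw)) hwv
  have h1 := isMeagre_diff_nonmeagerPoints (range g)
  have h3 := hbad.mono h2
  rw [show range g = (nonmeagerPoints (range g) \ (nonmeagerPoints (range g) \ range g)) ∪
    (range g \ nonmeagerPoints (range g)) by grind]
  exact ((isClosed_nonmeagerPoints _).isOpen_compl.baireMeasurableSet.of_compl.diff
    h3.baireMeasurableSet).union h1.baireMeasurableSet

end BaireProperty

section Coding

/-- Replace the last index read, counting the number of changes. -/
def moveTo (q : Fin 3 × ℕ) : Option (Fin 3) → Fin 3 × ℕ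
  | none => q
  | some i => if i = q.1 then q else (i, q.2 + 1)

/-- The last odd index and the number of its changes, after reading `n` bits of a triple. -/
def oddRun (p : (ℕ → Bool) × (ℕ → Bool) × (ℕ → Bool)) : ℕ → Fin 3 × ℕ
  | 0 => (0, 0)
  | n + 1 => moveTo (oddRun p n) (oddOne (p.1 n) (p.2.1 n) (p.2.2 n))

/-- The sequence of directions in which the odd index of a triple changes. -/
noncomputable def turns (p : (ℕ → Bool) × (ℕ → Bool) × (ℕ → Bool)) (k : ℕ) : Bool := by
  classical
  exact decide (∃ n m a, oddRun p n = (a, k) ∧ oddRun p m = (a + 1, k + 1))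

theorem measurable_oddRun (n : ℕ) : Measurable fun p => oddRun p n := by
  induction n with
  | zero => exact measurable_const
  | succ n ih =>
    have h : Measurable fun t : (Fin 3 × ℕ) × Bool × Bool × Bool =>
        moveTo t.1 (oddOne t.2.1 t.2.2.1 t.2.2.2) := Measurable.of_discrete
    exact h.comp (f := fun p : (ℕ → Bool) × (ℕ → Bool) × (ℕ → Bool) =>
      (oddRun p n, p.1 n, p.2.1 n, p.2.2 n)) (by fun_prop)

theorem measurable_turns : Measurable turns := by
  refine measurable_pi_lambda _ fun k => ?_
  refine measurable_to_bool ?_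
  have : (fun p => turns p k) ⁻¹' {true} = ⋃ n, ⋃ m, ⋃ a : Fin 3,
      ((fun p => oddRun p n) ⁻¹' {(a, k)} ∩ (fun p => oddRun p m) ⁻¹' {(a + 1, k + 1)}) := by
    ext p
    simp [turns]
  rw [this]
  exact .iUnion fun n => .iUnion fun m => .iUnion fun a =>
    (measurable_oddRun n (.singleton _)).inter (measurable_oddRun m (.singleton _))

theorem oddRun_add_eq_or_lt (p : (ℕ → Bool) × (ℕ → Bool) × (ℕ → Bool)) (n d : ℕ) :
    oddRun p (n + d) = oddRun p n ∨ (oddRun p n).2 < (oddRun p (n + d)).2 := by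
  induction d with
  | zero => exact .inl rfl
  | succ d ih =>
    have : oddRun p (n + (d + 1)) = oddRun p (n + d) ∨
        (oddRun p (n + (d + 1))).2 = (oddRun p (n + d)).2 + 1 := by
      rw [← add_assoc, oddRun]
      cases oddOne (p.1 (n + d)) (p.2.1 (n + d)) (p.2.2 (n + d)) with
      | none => exact .inl rfl
      | some i => dsimp only [moveTo]; split_ifs <;> simp
    rcases this with h | h <;> rcases ih with h' | h' <;> grind

theorem oddRun_fst_unique {p : (ℕ → Bool) × (ℕ → Bool) × (ℕ → Bool)} {n m k : ℕ} {a b : Fin 3}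
    (hn : oddRun p n = (a, k)) (hm : oddRun p m = (b, k)) : a = b := by
  wlog h : n ≤ m generalizing n m a b
  · exact (this hm hn (le_of_not_ge h)).symm
  obtain ⟨d, rfl⟩ := Nat.exists_eq_add_of_le h
  rcases oddRun_add_eq_or_lt p n d with h | h
  · grind
  · simp [hn, hm] at h

theorem oddRun_block {p : (ℕ → Bool) × (ℕ → Bool) × (ℕ → Bool)} {l : ℕ} {q : Fin 3 × ℕ}
    {i : Fin 3} (hq : oddRun p l = q) (hi : i ≠ q.1) (d : ℕ) (S : Set ℕ)
    (hS : ∀ j, l ≤ j → j < l + d →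
      oddOne (p.1 j) (p.2.1 j) (p.2.2 j) = open Classical in if j ∈ S then some i else none) :
    oddRun p (l + d) = open Classical in
      if ∃ j ∈ S, l ≤ j ∧ j < l + d then (i, q.2 + 1) else q := by
  induction d with
  | zero => rw [if_neg (by rintro ⟨j, -, h, h'⟩; omega)]; exact hq
  | succ d ih =>
    rw [← add_assoc, oddRun, ih fun j h h' => hS j h (by omega), hS (l + d) (by omega) (by omega)]
    by_cases h1 : ∃ j ∈ S, l ≤ j ∧ j < l + d
    · obtain ⟨j, hjS, hj, hj'⟩ := h1
      have h1' : ∃ j ∈ S, l ≤ j ∧ j < l + d + 1 := ⟨j, hjS, hj, by omega⟩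
      rw [if_pos ⟨j, hjS, hj, hj'⟩, if_pos h1']
      split_ifs <;> simp [moveTo]
    · rw [if_neg h1]
      by_cases h2 : l + d ∈ S
      · have h2' : ∃ j ∈ S, l ≤ j ∧ j < l + d + 1 := ⟨l + d, h2, by omega, by omega⟩
        rw [if_pos h2, if_pos h2']
        simp [moveTo, hi]
      · rw [if_neg h2, if_neg]
        · rfl
        · rintro ⟨j, hjS, hj, hj'⟩
          rcases eq_or_ne j (l + d) with rfl | hne
          · exact h2 hjS
          · exact h1 ⟨j, hjS, hj, by omega⟩

/-- Start from `a` and turn up or down according to the bits of `u`. -/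
def turnFrom (a : Fin 3) (u : ℕ → Bool) : ℕ → Fin 3
  | 0 => a
  | n + 1 => turnFrom a u n + if u n then 1 else 2

theorem turnFrom_succ_ne (a : Fin 3) (u : ℕ → Bool) (n : ℕ) :
    turnFrom a u (n + 1) ≠ turnFrom a u n := by
  rw [turnFrom]
  generalize turnFrom a u n = b
  cases u n <;> revert b <;> decide

/-- If from position `ℓ 0` on, the odd index in the `n`-th block is `turnFrom a u (n + 1)`, then
`turns` eventually reads off `u`. -/
theorem turns_eq {p : (ℕ → Bool) × (ℕ → Bool) × (ℕ → Bool)} {ℓ : ℕ → ℕ} (hℓ : StrictMono ℓ)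
    (h : ℕ → Set ℕ) (hne : ∀ n, (h n).Nonempty) (hsub : ∀ n, h n ⊆ Ico (ℓ n) (ℓ (n + 1)))
    {a : Fin 3} {r : ℕ} (h0 : oddRun p (ℓ 0) = (a, r)) (u : ℕ → Bool)
    (hodd : ∀ n, ∀ j ∈ Ico (ℓ n) (ℓ (n + 1)), oddOne (p.1 j) (p.2.1 j) (p.2.2 j) =
      open Classical in if j ∈ h n then some (turnFrom a u (n + 1)) else none) (n : ℕ) :
    turns p (r + n) = u n := by
  have hrun : ∀ n, oddRun p (ℓ n) = (turnFrom a u n, r + n) := by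
    intro n
    induction n with
    | zero => exact h0
    | succ n ih =>
      have hlt := hℓ (Nat.lt_succ_self n)
      obtain ⟨d, hd⟩ := Nat.exists_eq_add_of_le hlt.le
      obtain ⟨j, hj⟩ := hne n
      have hj' := hsub n hj
      rw [Nat.succ_eq_add_one] at hd
      rw [hd] at hj' ⊢
      rw [oddRun_block ih (turnFrom_succ_ne a u n) d (h n)
        fun j h1 h2 => hodd n j ⟨h1, by omega⟩, if_pos ⟨j, hj, hj'.1, hj'.2⟩]
      rfl
  cases hu : u n with
  | true =>
    simp only [turns, decide_eq_true_eq]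
    refine ⟨ℓ n, ℓ (n + 1), _, hrun n, ?_⟩
    rw [hrun, turnFrom, hu]
    rfl
  | false =>
    simp only [turns, decide_eq_false_iff_not]
    rintro ⟨m, m', b, hm, hm'⟩
    have e1 := oddRun_fst_unique hm (hrun n)
    have e2 := oddRun_fst_unique hm' (hrun (n + 1))
    rw [e1, turnFrom, hu] at e2
    generalize turnFrom a u n = c at e2
    revert c
    decide

end Coding

section Flips

open PiNat

theorem E0.symm {α : Type*} {x y : ℕ → α} : E0 x y → E0 y x := fun ⟨n, h⟩ =>
  ⟨n, fun k hk => (h k hk).symm⟩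

/-- Flip the bits of `x` at the places marked by `g`. -/
def flipBy (g x : ℕ → Bool) (m : ℕ) : Bool := g m ^^ x m

/-- The characteristic function of a finite set. -/
def charFun (S : Finset ℕ) (m : ℕ) : Bool := decide (m ∈ S)

theorem flipBy_flipBy (g x : ℕ → Bool) : flipBy g (flipBy g x) = x := by
  funext m
  simp [flipBy]

theorem continuous_flipBy (g : ℕ → Bool) : Continuous (flipBy g) :=
  continuous_pi fun m => (continuous_of_discreteTopology (f := fun b => (g m ^^ b))).comp
    (continuous_apply m)

theorem isOpenMap_flipBy (g : ℕ → Bool) : IsOpenMap (flipBy g) :=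
  (Homeomorph.mk ⟨flipBy g, flipBy g, flipBy_flipBy g, flipBy_flipBy g⟩
    (continuous_flipBy g) (continuous_flipBy g)).isOpenMap

theorem E0_flipBy {g : ℕ → Bool} {L : ℕ} (hg : ∀ m, g m = true → m < L) (x : ℕ → Bool) :
    E0 x (flipBy g x) := by
  refine ⟨L, fun k hk => ?_⟩
  have : g k = false := by
    by_contra h
    have := hg k (by simpa using h)
    omega
  simp [flipBy, this]

theorem lt_of_charFun {S : Finset ℕ} {m : ℕ} (h : charFun S m = true) : m < S.sup id + 1 :=
  Nat.lt_succ_of_le (Finset.le_sup (f := id) (by simpa [charFun] using h))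

theorem E0.exists_flipBy {x y : ℕ → Bool} (h : E0 x y) :
    ∃ S : Finset ℕ, y = flipBy (charFun S) x := by
  obtain ⟨n, h⟩ := h
  refine ⟨(Finset.range (n + 1)).filter fun m => x m ≠ y m, ?_⟩
  funext m
  have := h m
  simp only [flipBy, charFun, Finset.mem_filter, Finset.mem_range]
  by_cases hm : m < n + 1
  · cases x m <;> cases y m <;> simp [hm]
  · simp [hm, h m (by omega)]

theorem exists_cylinder_subset {x : ℕ → Bool} {U : Set (ℕ → Bool)} (hU : U ∈ 𝓝 x) :
    ∃ L, cylinder x L ⊆ U := by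
  obtain ⟨_, ⟨z, n, rfl⟩, hx, hzU⟩ :=
    (isTopologicalBasis_cylinders fun _ => Bool).mem_nhds_iff.1 hU
  exact ⟨n, by rwa [mem_cylinder_iff_eq.1 hx]⟩

theorem isClosed_cylinder (x : ℕ → Bool) (n : ℕ) : IsClosed (cylinder x n) := by
  rw [cylinder_eq_pi]
  exact isClosed_set_pi fun _ _ => isClosed_discrete _

theorem ContinuousOn.exists_cylinder {f : (ℕ → Bool) → (ℕ → Bool)} {Z : Set (ℕ → Bool)}
    (hc : ContinuousOn f Z) {x : ℕ → Bool} (hx : x ∈ Z) (M : ℕ) :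
    ∃ L, ∀ y ∈ Z, y ∈ cylinder x L → f y ∈ cylinder (f x) M := by
  have := hc x hx ((isOpen_cylinder _ (f x) M).mem_nhds (self_mem_cylinder _ _))
  rw [mem_map, mem_nhdsWithin_iff_exists_mem_nhds_inter] at this
  obtain ⟨u, hu, hsub⟩ := this
  obtain ⟨L, hL⟩ := exists_cylinder_subset hu
  exact ⟨L, fun y hy hyL => hsub ⟨hL hyL, hy⟩⟩

theorem exists_mem_cylinder_of_residual {Z : Set (ℕ → Bool)} (hZ : Z ∈ residual (ℕ → Bool))
    (x : ℕ → Bool) (n : ℕ) : ∃ y ∈ Z, y ∈ cylinder x n := by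
  obtain ⟨y, hy, hyZ⟩ := (dense_of_mem_residual hZ).inter_open_nonempty _
    (isOpen_cylinder _ x n) ⟨x, self_mem_cylinder x n⟩
  exact ⟨y, hyZ, hy⟩

theorem residual_forall_E0 {Z : Set (ℕ → Bool)} (hZ : Z ∈ residual (ℕ → Bool)) :
    {x | ∀ y, E0 x y → y ∈ Z} ∈ residual (ℕ → Bool) := by
  have : (⋂ S : Finset ℕ, flipBy (charFun S) ⁻¹' Z) ∈ residual (ℕ → Bool) :=
    countable_iInter_mem.2 fun S =>
      tendsto_residual_of_isOpenMap (continuous_flipBy _) (isOpenMap_flipBy _) hZ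
  filter_upwards [this] with x hx y hxy
  obtain ⟨S, rfl⟩ := hxy.exists_flipBy
  exact mem_iInter.1 hx S

theorem residual_compl_singleton (x : ℕ → Bool) : {x}ᶜ ∈ residual (ℕ → Bool) := by
  refine residual_of_dense_open isOpen_compl_singleton ?_
  rw [dense_compl_singleton_iff_not_open]
  intro h
  obtain ⟨L, hL⟩ := exists_cylinder_subset (h.mem_nhds rfl)
  have : Function.update x L (!x L) ∈ ({x} : Set (ℕ → Bool)) := hL (update_mem_cylinder _ _ _)
  have := congrFun this L
  simp at this

/-- A Borel function is continuous on a residual set. -/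
theorem Measurable.exists_residual_continuousOn {X Y : Type*} [TopologicalSpace X]
    [MeasurableSpace X] [BorelSpace X] [TopologicalSpace Y] [SecondCountableTopology Y]
    [MeasurableSpace Y] [OpensMeasurableSpace Y] {f : X → Y} (hf : Measurable f) :
    ∃ Z ∈ residual X, ContinuousOn f Z := by
  have hB := TopologicalSpace.isBasis_countableBasis Y
  have : ∀ V ∈ TopologicalSpace.countableBasis Y, ∃ u : Set X, IsOpen u ∧ f ⁻¹' V =ᵇ u :=
    fun V hV => (hf (hB.isOpen hV).measurableSet).residualEq_isOpen
  choose! u hu hfu using this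
  refine ⟨{x | ∀ V ∈ TopologicalSpace.countableBasis Y, x ∈ f ⁻¹' V ↔ x ∈ u V}, ?_, ?_⟩
  · exact (eventually_countable_ball (TopologicalSpace.countable_countableBasis Y)).2
      fun V hV => (hfu V hV).mem_iff
  · intro x hx
    rw [ContinuousWithinAt, (hB.nhds_hasBasis (a := f x)).tendsto_right_iff]
    rintro V ⟨hV, hxV⟩
    filter_upwards [self_mem_nhdsWithin,
      mem_nhdsWithin_of_mem_nhds ((hu V hV).mem_nhds ((hx V hV).1 hxV))] with y hy hyV
    exact (hy V hV).2 hyV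

end Flips

section Fusion

open PiNat

theorem exists_cylinder_forall_tail_mem {O : Set (ℕ → Bool)} (hO : IsOpen O) (hd : Dense O)
    (p : ℕ → Bool) (L : ℕ) : ∃ q ∈ cylinder p L, ∃ N ≥ L, ∀ y ∈ cylinder q N,
      ∀ z, (∀ m ≥ L, z m = y m) → z ∈ O := by
  let G : (Fin L → Bool) → ℕ → Bool := fun s m => if h : m < L then s ⟨m, h⟩ else false
  have hopen : IsOpen (⋂ s, flipBy (G s) ⁻¹' O) :=
    isOpen_iInter_of_finite fun s => hO.preimage (continuous_flipBy _)
  have hdense : Dense (⋂ s, flipBy (G s) ⁻¹' O) :=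
    dense_iInter_of_isOpen (fun s => hO.preimage (continuous_flipBy _))
      fun s => hd.preimage (isOpenMap_flipBy _)
  obtain ⟨q, hq, hqO⟩ := hdense.inter_open_nonempty _ (isOpen_cylinder _ p L)
    ⟨p, self_mem_cylinder p L⟩
  obtain ⟨N, hN⟩ := exists_cylinder_subset (hopen.mem_nhds hqO)
  refine ⟨q, hq, max L N, le_max_left _ _, fun y hy z hz => ?_⟩
  have := mem_iInter.1 (hN (cylinder_anti q (le_max_right L N) hy)) fun i => (y i ^^ z i)
  rw [mem_preimage] at this
  convert this using 1
  funext m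
  by_cases hm : m < L
  · simp only [flipBy, G, dif_pos hm]
    cases y m <;> cases z m <;> rfl
  · simp [flipBy, G, hm, hz m (by omega)]

variable {f : (ℕ → Bool) → (ℕ → Bool)} {Z : Set (ℕ → Bool)}

theorem exists_E0_ne_of_reduction (hf : ∀ x y, E0 x y ↔ E0 (f x) (f y))
    (hZ : Z ∈ residual (ℕ → Bool)) (hinv : ∀ x y, E0 x y → x ∈ Z → y ∈ Z)
    (hc : ContinuousOn f Z) (q : ℕ → Bool) (N : ℕ) :
    ∃ x ∈ Z, ∃ y ∈ Z, x ∈ cylinder q N ∧ y ∈ cylinder q N ∧ E0 x y ∧ f x ≠ f y := by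
  by_contra! hcon
  obtain ⟨x, hxZ, hxq⟩ := exists_mem_cylinder_of_residual hZ q N
  obtain ⟨y, ⟨hyZ, hyx⟩, hyq⟩ := exists_mem_cylinder_of_residual
    (inter_mem hZ (residual_forall_E0 (residual_compl_singleton x))) q N
  have hne : f x ≠ f y := fun h => hyx x ((hf y x).2 ⟨0, fun k _ => by rw [h]⟩) rfl
  obtain ⟨m, hm⟩ := Function.ne_iff.1 hne
  obtain ⟨K, hK⟩ := hc.exists_cylinder hyZ (m + 1)
  let z : ℕ → Bool := fun j => if j < max K N then y j else x j
  have hxz : E0 x z := ⟨max K N, fun k hk => by simp only [z]; rw [if_neg (by omega)]⟩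
  have hzZ := hinv x z hxz hxZ
  have hzq : z ∈ cylinder q N := fun i hi => by
    simp only [z]
    rw [if_pos (by omega)]
    exact hyq i hi
  have hzK : z ∈ cylinder y K := fun i hi => by
    simp only [z]
    rw [if_pos (by omega)]
  apply hm
  rw [hcon x hxZ z hzZ hxq hzq hxz]
  exact hK z hzZ hzK m (by omega)

theorem exists_flipBy_commute (hf : ∀ x y, E0 x y ↔ E0 (f x) (f y))
    (hZ : Z ∈ residual (ℕ → Bool)) (hinv : ∀ x y, E0 x y → x ∈ Z → y ∈ Z)
    (hc : ContinuousOn f Z) (q : ℕ → Bool) (N : ℕ) :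
    ∃ p ∈ Z, p ∈ cylinder q N ∧ ∃ L ≥ N, ∃ g : ℕ → Bool, ∃ S : Finset ℕ,
      S.Nonempty ∧ (∀ m, g m = true → N ≤ m ∧ m < L) ∧
      ∀ x ∈ Z, x ∈ cylinder p L → f (flipBy g x) = flipBy (charFun S) (f x) := by
  obtain ⟨x, hxZ, y, hyZ, hxq, hyq, hxy, hne⟩ := exists_E0_ne_of_reduction hf hZ hinv hc q N
  obtain ⟨m, hm⟩ := Function.ne_iff.1 hne
  obtain ⟨K₁, hK₁⟩ := hc.exists_cylinder hxZ (m + 1)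
  obtain ⟨K₂, hK₂⟩ := hc.exists_cylinder hyZ (m + 1)
  set g := flipBy x y with hg
  obtain ⟨B, hB⟩ : ∃ B, ∀ j, g j = true → N ≤ j ∧ j < B := by
    obtain ⟨n, hn⟩ := hxy
    refine ⟨n + 1, fun j hj => ?_⟩
    have hj' : x j ≠ y j := fun h => by simp [hg, flipBy, h] at hj
    constructor
    · by_contra! h
      exact hj' ((hxq j h).trans (hyq j h).symm)
    · by_contra! h
      exact hj' (hn j (by omega))
  have hE : ∀ z, E0 z (flipBy g z) := E0_flipBy fun j hj => (hB j hj).2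
  set K := max N (max K₁ K₂) with hK
  have hflip : ∀ z ∈ cylinder x K, flipBy g z ∈ cylinder y K := fun z hz i hi => by
    simp only [hg, flipBy, hz i hi]
    cases x i <;> cases y i <;> rfl
  have hdiff : ∀ z ∈ Z, z ∈ cylinder x K → f (flipBy g z) m ≠ f z m := fun z hz hzK => by
    rw [hK₁ z hz (cylinder_anti x (by omega) hzK) m (by omega),
      hK₂ _ (hinv _ _ (hE z) hz) (cylinder_anti y (by omega) (hflip z hzK)) m (by omega)]
    exact hm.symm
  let C : Finset ℕ → Set (ℕ → Bool) := fun S =>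
    {z | z ∈ Z ∧ z ∈ cylinder x K ∧ f (flipBy g z) = flipBy (charFun S) (f z)}
  obtain ⟨S, hS⟩ : ∃ S, ¬IsNowhereDense (C S) := by
    by_contra! h
    obtain ⟨z, ⟨hzZ, hzC⟩, hzK⟩ := exists_mem_cylinder_of_residual
      (inter_mem hZ (isMeagre_iUnion fun S => (h S).isMeagre)) x K
    obtain ⟨S, hS⟩ := ((hf _ _).1 (hE z)).exists_flipBy
    exact hzC (mem_iUnion.2 ⟨S, hzZ, hzK, hS⟩)
  obtain ⟨p, hp, hpZ⟩ := (dense_of_mem_residual hZ).inter_open_nonempty _ isOpen_interior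
    (nonempty_iff_ne_empty.2 hS)
  obtain ⟨L, hL⟩ := exists_cylinder_subset (isOpen_interior.mem_nhds hp)
  have hpK : p ∈ cylinder x K :=
    closure_minimal (fun z hz => hz.2.1) (isClosed_cylinder x K) (interior_subset hp)
  have hcomm : ∀ z ∈ Z, z ∈ cylinder p L → f (flipBy g z) = flipBy (charFun S) (f z) := by
    intro z hz hzL
    funext j
    obtain ⟨L₁, hL₁⟩ := hc.exists_cylinder hz (j + 1)
    obtain ⟨L₂, hL₂⟩ := hc.exists_cylinder (hinv _ _ (hE z) hz) (j + 1)
    obtain ⟨z', hz'L, hz'Z, -, hz'⟩ := mem_closure_iff.1 (interior_subset (hL hzL)) _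
      (isOpen_cylinder _ z (max L₁ L₂)) (self_mem_cylinder _ _)
    have e1 := hL₁ z' hz'Z (cylinder_anti z (le_max_left _ _) hz'L) j (by omega)
    have e2 := hL₂ _ (hinv _ _ (hE z') hz'Z)
      (fun i hi => by simp only [flipBy]; rw [hz'L i (by omega)]) j (by omega)
    rw [← e2, hz', flipBy, flipBy, e1]
  refine ⟨p, hpZ, fun i hi => (hpK i (by omega)).trans (hxq i hi), max (max L N) B, by omega, g, S,
    ⟨m, ?_⟩, fun j hj => ⟨(hB j hj).1, lt_of_lt_of_le (hB j hj).2 (le_max_right _ _)⟩,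
    fun z hz hzL => hcomm z hz (cylinder_anti p (by omega) hzL)⟩
  by_contra hmS
  apply hdiff p hpZ hpK
  rw [hcomm p hpZ (self_mem_cylinder _ _)]
  simp [flipBy, charFun, hmS]

/-- A point together with the lengths of the initial segments of it and of its image that are
already decided. -/
structure FusionStage where
  /-- The approximating point. -/
  pt : ℕ → Bool
  /-- The number of decided bits of the point. -/
  dom : ℕ
  /-- The number of decided bits of its image. -/
  cod : ℕ

/-- The decided bits of the point decide the decided bits of the image. -/
def FusionStage.IsGood (f : (ℕ → Bool) → (ℕ → Bool)) (Z : Set (ℕ → Bool)) (s : FusionStage) :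
    Prop :=
  s.pt ∈ Z ∧ ∀ x ∈ Z, x ∈ cylinder s.pt s.dom → f x ∈ cylinder (f s.pt) s.cod

/-- The stage `t` refines `s`, adding a flip `g` of the point that acts as the flip `h` on the
image, and forcing all tails of later points into `O`. -/
structure FusionStage.Refines (f : (ℕ → Bool) → (ℕ → Bool)) (Z O : Set (ℕ → Bool))
    (s t : FusionStage) (g h : ℕ → Bool) : Prop where
  pt_mem : t.pt ∈ cylinder s.pt s.dom
  dom_lt : s.dom < t.dom
  cod_lt : s.cod < t.cod
  g_supp : ∀ m, g m = true → s.dom ≤ m ∧ m < t.dom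
  h_supp : ∀ m, h m = true → s.cod ≤ m ∧ m < t.cod
  h_ne : ∃ m, h m = true
  comm : ∀ x ∈ Z, x ∈ cylinder t.pt t.dom → f (flipBy g x) = flipBy h (f x)
  tail_mem : ∃ N ≤ t.dom, (∀ m, g m = true → N ≤ m) ∧ ∀ y ∈ cylinder t.pt N,
    ∀ z, (∀ m ≥ s.dom, z m = y m) → z ∈ O

theorem FusionStage.IsGood.exists_refines (hf : ∀ x y, E0 x y ↔ E0 (f x) (f y))
    (hZ : Z ∈ residual (ℕ → Bool)) (hinv : ∀ x y, E0 x y → x ∈ Z → y ∈ Z)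
    (hc : ContinuousOn f Z) {O : Set (ℕ → Bool)} (hO : IsOpen O) (hd : Dense O)
    {s : FusionStage} (hs : s.IsGood f Z) :
    ∃ t g h, t.IsGood f Z ∧ s.Refines f Z O t g h := by
  obtain ⟨q, hq, N, hN, hqO⟩ := exists_cylinder_forall_tail_mem hO hd s.pt s.dom
  obtain ⟨p, hpZ, hpq, L, hL, g, S, hS, hg, hcomm⟩ := exists_flipBy_commute hf hZ hinv hc q N
  have hps : p ∈ cylinder s.pt s.dom := fun i hi => (hpq i (by omega)).trans (hq i hi)
  obtain ⟨L₁, hL₁⟩ := hc.exists_cylinder hpZ (max (s.cod + 1) (S.sup id + 1))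
  refine ⟨⟨p, max (L + 1) L₁, max (s.cod + 1) (S.sup id + 1)⟩, g, charFun S, ⟨hpZ, ?_⟩,
    hps, ?_, ?_, ?_, ?_, ?_, ?_, N, ?_, ?_, ?_⟩
  · exact fun x hx hxp => hL₁ x hx (cylinder_anti p (le_max_right _ _) hxp)
  · dsimp only; omega
  · dsimp only; omega
  · intro m hm
    have := hg m hm
    dsimp only
    omega
  · intro m hm
    have := lt_of_charFun hm
    refine ⟨?_, lt_of_lt_of_le this (le_max_right _ _)⟩
    by_contra! hlt
    have e1 := hs.2 p hpZ hps m hlt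
    have e2 := hs.2 (flipBy g p) (hinv _ _ (E0_flipBy (fun j hj => (hg j hj).2) p) hpZ) (by
      intro i hi
      have : g i = false := by
        by_contra h
        have := hg i (by simpa using h)
        omega
      simp [flipBy, this, hps i hi]) m hlt
    rw [hcomm p hpZ (self_mem_cylinder _ _), flipBy, hm, ← e1] at e2
    simp at e2
  · obtain ⟨m, hm⟩ := hS
    exact ⟨m, by simp [charFun, hm]⟩
  · exact fun x hx hxp => hcomm x hx
      (cylinder_anti p ((Nat.le_succ L).trans (le_max_left _ _)) hxp)
  · dsimp only; omega
  · exact fun m hm => (hg m hm).1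
  · intro y hy z hz
    exact hqO y (fun i hi => (hy i hi).trans (hpq i hi)) z hz

/-- The flip composed of those among the first `n` flips in `g` that are selected by `b`. -/
def flipSum (g : ℕ → ℕ → Bool) (b : ℕ → Bool) : ℕ → ℕ → Bool
  | 0 => fun _ => false
  | n + 1 => fun m => (b n && g n m) ^^ flipSum g b n m

/-- The flip composed of all flips in `g` selected by `b`, if `g n m` is false for `m < n`. -/
def flipLim (g : ℕ → ℕ → Bool) (b : ℕ → Bool) (m : ℕ) : Bool := flipSum g b (m + 1) m

section FlipSum

variable {g : ℕ → ℕ → Bool} {ℓ : ℕ → ℕ}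

theorem flipSum_eq_false (hℓ : StrictMono ℓ) (hg : ∀ n m, g n m = true → ℓ n ≤ m ∧ m < ℓ (n + 1))
    (b : ℕ → Bool) {n m : ℕ} (hm : m < ℓ 0 ∨ ℓ n ≤ m) : flipSum g b n m = false := by
  induction n with
  | zero => rfl
  | succ n ih =>
    have h1 := hℓ (Nat.lt_add_one n)
    have h0 := hℓ.monotone n.zero_le
    have : g n m = false := by
      by_contra h
      have := hg n m (by simpa using h)
      omega
    simp only [flipSum, this, ih (by omega)]
    simp

theorem flipSum_eq (hℓ : StrictMono ℓ) (hg : ∀ n m, g n m = true → ℓ n ≤ m ∧ m < ℓ (n + 1))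
    (b : ℕ → Bool) {n N m : ℕ} (hn : n < N) (hm : ℓ n ≤ m) (hm' : m < ℓ (n + 1)) :
    flipSum g b N m = (b n && g n m) := by
  induction N with
  | zero => omega
  | succ N ih =>
    rcases eq_or_lt_of_le (Nat.le_of_lt_succ hn) with rfl | hlt
    · simp [flipSum, flipSum_eq_false hℓ hg b (Or.inr hm)]
    · have h1 := hℓ.monotone (show n + 1 ≤ N from hlt)
      have : g N m = false := by
        by_contra h
        have := hg N m (by simpa using h)
        omega
      simp [flipSum, this, ih hlt]

theorem flipSum_eq_flipLim (hℓ : StrictMono ℓ)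
    (hg : ∀ n m, g n m = true → ℓ n ≤ m ∧ m < ℓ (n + 1)) (b : ℕ → Bool) {N m : ℕ} (hm : m < ℓ N) :
    flipSum g b N m = flipLim g b m := by
  by_cases h0 : m < ℓ 0
  · rw [flipLim, flipSum_eq_false hℓ hg b (.inl h0), flipSum_eq_false hℓ hg b (.inl h0)]
  obtain ⟨n, hn, hn'⟩ : ∃ n, ℓ n ≤ m ∧ m < ℓ (n + 1) := by
    have hex : ∃ k, m < ℓ k := ⟨N, hm⟩
    classical
    refine ⟨Nat.find hex - 1, ?_⟩
    have h1 : Nat.find hex ≠ 0 := fun h => h0 (h ▸ Nat.find_spec hex)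
    have h2 := Nat.find_min hex (show Nat.find hex - 1 < Nat.find hex by omega)
    have h3 := Nat.find_spec hex
    rw [show Nat.find hex - 1 + 1 = Nat.find hex by omega]
    exact ⟨not_lt.1 h2, h3⟩
  have h1 : n < N := hℓ.lt_iff_lt.1 (hn.trans_lt hm)
  have h2 : n ≤ ℓ n := hℓ.id_le n
  rw [flipLim, flipSum_eq hℓ hg b h1 hn hn', flipSum_eq hℓ hg b (by omega) hn hn']

theorem E0_flipSum (hℓ : StrictMono ℓ) (hg : ∀ n m, g n m = true → ℓ n ≤ m ∧ m < ℓ (n + 1))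
    (b : ℕ → Bool) (n : ℕ) (x : ℕ → Bool) : E0 x (flipBy (flipSum g b n) x) :=
  E0_flipBy (L := ℓ n) (fun m hm => by
    by_contra! h
    rw [flipSum_eq_false hℓ hg b (.inr h)] at hm
    cases hm) x

end FlipSum

/-- If a reduction `f` of `E₀` to itself is continuous on an invariant residual set, then the image
of each nonempty open set contains, up to finite changes, all selections from a sequence of flips
with successive supports. -/
theorem exists_flips_of_reduction (hf : ∀ x y, E0 x y ↔ E0 (f x) (f y))
    (hZ : Z ∈ residual (ℕ → Bool)) (hinv : ∀ x y, E0 x y → x ∈ Z → y ∈ Z)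
    (hc : ContinuousOn f Z) {V : Set (ℕ → Bool)} (hV : IsOpen V) (hne : V.Nonempty) (M : ℕ) :
    ∃ (w : ℕ → Bool) (ℓ : ℕ → ℕ) (h : ℕ → ℕ → Bool), StrictMono ℓ ∧ M ≤ ℓ 0 ∧
      (∀ n, ∃ m, h n m = true) ∧ (∀ n m, h n m = true → ℓ n ≤ m ∧ m < ℓ (n + 1)) ∧
      ∀ b, ∃ y ∈ Z ∩ V, f y = flipBy (flipLim h b) w := by
  obtain ⟨T, hTZ, hT, hTd⟩ := mem_residual.1 hZ
  obtain ⟨O, hO, rfl⟩ := isGδ_iff_eq_iInter_nat.1 hT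
  have hOd : ∀ n, Dense (O n) := fun n => hTd.mono (iInter_subset _ n)
  obtain ⟨p, hpV, hpZ⟩ := (dense_of_mem_residual hZ).inter_open_nonempty V hV hne
  obtain ⟨L₁, hL₁⟩ := exists_cylinder_subset (hV.mem_nhds hpV)
  obtain ⟨L₂, hL₂⟩ := hc.exists_cylinder hpZ M
  let s₀ : {s : FusionStage // s.IsGood f Z} := ⟨⟨p, max L₁ L₂, M⟩, hpZ, fun x hx hxp =>
    hL₂ x hx (cylinder_anti p (le_max_right _ _) hxp)⟩
  have hstep : ∀ (n : ℕ) (s : {s : FusionStage // s.IsGood f Z}),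
      ∃ (t : {s : FusionStage // s.IsGood f Z}) (g h : ℕ → Bool),
        s.1.Refines f Z (O n) t.1 g h := by
    intro n s
    obtain ⟨t, g, h, ht, hr⟩ := s.2.exists_refines hf hZ hinv hc (hO n) (hOd n)
    exact ⟨⟨t, ht⟩, g, h, hr⟩
  choose next gg hh hnext using hstep
  let s : ℕ → {s : FusionStage // s.IsGood f Z} := fun n => Nat.rec s₀ (fun n t => next n t) n
  let g : ℕ → ℕ → Bool := fun n => gg n (s n)
  let h : ℕ → ℕ → Bool := fun n => hh n (s n)
  have hr : ∀ n, (s n).1.Refines f Z (O n) (s (n + 1)).1 (g n) (h n) := fun n => hnext n (s n)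
  have hgood : ∀ n, (s n).1.IsGood f Z := fun n => (s n).2
  have hd : StrictMono fun n => (s n).1.dom := strictMono_nat_of_lt_succ fun n => (hr n).dom_lt
  have hcd : StrictMono fun n => (s n).1.cod := strictMono_nat_of_lt_succ fun n => (hr n).cod_lt
  have hs0 : (s 0).1 = ⟨p, max L₁ L₂, M⟩ := rfl
  clear_value s g h
  have hgs := fun n => (hr n).g_supp
  have hhs := fun n => (hr n).h_supp
  have hdle : ∀ n, n ≤ (s n).1.dom := fun n => hd.id_le n
  have hcle : ∀ n, n ≤ (s n).1.cod := fun n => hcd.id_le n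
  have hpts : ∀ n k, (s (n + k)).1.pt ∈ cylinder (s n).1.pt (s n).1.dom := by
    intro n k
    induction k with
    | zero => exact self_mem_cylinder _ _
    | succ k ih =>
      intro i hi
      exact ((hr (n + k)).pt_mem i (hi.trans_le (hd.monotone (Nat.le_add_right n k)))).trans
        (ih i hi)
  let x : ℕ → Bool := fun m => (s (m + 1)).1.pt m
  have hx : ∀ n, x ∈ cylinder (s n).1.pt (s n).1.dom := by
    intro n i hi
    simp only [x]
    rcases le_total n (i + 1) with hle | hle
    · obtain ⟨k, hk⟩ := Nat.exists_eq_add_of_le hle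
      rw [hk]
      exact hpts n k i hi
    · obtain ⟨k, hk⟩ := Nat.exists_eq_add_of_le hle
      rw [hk]
      exact (hpts (i + 1) k i (hdle (i + 1))).symm
  let y : (ℕ → Bool) → ℕ → Bool := fun b => flipBy (flipLim g b) x
  let tl : (ℕ → Bool) → ℕ → ℕ → Bool := fun b n => flipBy (flipSum g b n) (y b)
  have htl_lt : ∀ b n m, m < (s n).1.dom → tl b n m = x m := by
    intro b n m hm
    simp only [tl, y, flipBy, flipSum_eq_flipLim hd hgs b hm]
    cases flipLim g b m <;> simp
  have htl_ge : ∀ b n m, (s n).1.dom ≤ m → tl b n m = y b m := by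
    intro b n m hm
    simp only [tl, flipBy, flipSum_eq_false hd hgs b (.inr hm)]
    simp
  have htl_cyl : ∀ b n, tl b n ∈ cylinder (s n).1.pt (s n).1.dom := fun b n i hi =>
    (htl_lt b n i hi).trans (hx n i hi)
  have hyZ : ∀ b, y b ∈ Z := by
    intro b
    refine hTZ (mem_iInter.2 fun n => ?_)
    obtain ⟨N, hN, hgN, htail⟩ := (hr n).tail_mem
    refine htail (tl b n) (fun i hi => ?_) (y b) fun m hm => (htl_ge b n m hm).symm
    have hi' : i < (s (n + 1)).1.dom := by omega
    rw [← hx (n + 1) i hi']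
    by_cases hin : i < (s n).1.dom
    · exact htl_lt b n i hin
    · have hg0 : g n i = false := by
        by_contra hg1
        have := hgN i (by simpa using hg1)
        omega
      rw [htl_ge b n i (not_lt.1 hin)]
      simp only [y, flipBy, ← flipSum_eq_flipLim hd hgs b hi',
        flipSum_eq hd hgs b n.lt_succ_self (not_lt.1 hin) hi', hg0]
      simp
  have htlZ : ∀ b n, tl b n ∈ Z := fun b n => hinv _ _ (E0_flipSum hd hgs b n (y b)) (hyZ b)
  have hcomm : ∀ b n, ∀ z ∈ Z, z ∈ cylinder (s n).1.pt (s n).1.dom →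
      f (flipBy (flipSum g b n) z) = flipBy (flipSum h b n) (f z) := by
    intro b n
    induction n with
    | zero =>
      have e : ∀ v, flipBy (fun _ => false) v = v := fun v => by funext m; simp [flipBy]
      intro z _ _
      simp only [flipSum, e]
    | succ n ih =>
      intro z hz hzs
      cases hb : b n with
      | false =>
        have e : ∀ k : ℕ → ℕ → Bool, flipSum k b (n + 1) = flipSum k b n := fun k => by
          funext m; simp [flipSum, hb]
        rw [e, e]
        exact ih z hz fun i hi => (hzs i (hi.trans (hr n).dom_lt)).trans ((hr n).pt_mem i hi)
      | true =>
        have e : ∀ (k : ℕ → ℕ → Bool) (v : ℕ → Bool),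
            flipBy (flipSum k b (n + 1)) v = flipBy (flipSum k b n) (flipBy (k n) v) := fun k v => by
          funext m
          simp only [flipBy, flipSum, hb, Bool.true_and]
          rw [Bool.xor_comm (k n m), Bool.xor_assoc]
        rw [e, e, ← (hr n).comm z hz hzs]
        refine ih _ (hinv _ _ (E0_flipBy (fun m hm => (hgs n m hm).2) z) hz) fun i hi => ?_
        have hg0 : g n i = false := by
          by_contra hg1
          have := hgs n i (by simpa using hg1)
          omega
        simp only [flipBy, hg0, Bool.false_xor]
        exact (hzs i (hi.trans (hr n).dom_lt)).trans ((hr n).pt_mem i hi)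
  have hxZ : x ∈ Z := by
    have := hyZ fun _ => false
    have e : y (fun _ => false) = x := by
      have e' : ∀ n m, flipSum g (fun _ => false) n m = false := fun n m => by
        induction n with
        | zero => rfl
        | succ n ih => simp [flipSum, ih]
      funext m
      simp [y, flipBy, flipLim, e']
    rwa [e] at this
  refine ⟨f x, fun n => (s n).1.cod, h, hcd, by simp [hs0], fun n => (hr n).h_ne, hhs,
    fun b => ⟨y b, ⟨hyZ b, hL₁ ?_⟩, ?_⟩⟩
  · intro i hi
    have := htl_cyl b 0
    rw [show tl b 0 = y b by funext m; simp [tl, flipBy, flipSum], hs0] at this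
    exact this i (hi.trans_le (le_max_left _ _))
  · funext m
    have e := hcomm b (m + 1) (tl b (m + 1)) (htlZ b _) (htl_cyl b _)
    rw [flipBy_flipBy] at e
    rw [e]
    simp only [flipBy]
    rw [(hgood (m + 1)).2 _ (htlZ b _) (htl_cyl b _) m (hcle (m + 1)),
      ← (hgood (m + 1)).2 _ hxZ (hx _) m (hcle (m + 1))]
    rfl

end Fusion

section Triples

theorem E0.trans {α : Type*} {x y z : ℕ → α} : E0 x y → E0 y z → E0 x z :=
  fun ⟨n, h⟩ ⟨m, h'⟩ => ⟨max n m, fun k hk => (h k (by omega)).trans (h' k (by omega))⟩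

theorem oddRun_congr {p q : (ℕ → Bool) × (ℕ → Bool) × (ℕ → Bool)} {n : ℕ}
    (h : ∀ m < n, p.1 m = q.1 m ∧ p.2.1 m = q.2.1 m ∧ p.2.2 m = q.2.2 m) :
    oddRun p n = oddRun q n := by
  induction n with
  | zero => rfl
  | succ n ih =>
    obtain ⟨h1, h2, h3⟩ := h n n.lt_succ_self
    rw [oddRun, oddRun, ih fun m hm => h m (by omega), h1, h2, h3]

theorem oddRun_diag (w : ℕ → Bool) (n : ℕ) : oddRun (w, w, w) n = (0, 0) := by
  induction n with
  | zero => rfl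
  | succ n ih => simp [oddRun, ih, oddOne, moveTo]

variable {f : (ℕ → Bool) → (ℕ → Bool)}

theorem exists_mem_prodE0_turns_eq (hfm : Measurable f) (hf : ∀ x y, E0 x y ↔ E0 (f x) (f y))
    {A : Fin 3 → Set (ℕ → Bool)} {V : Set (ℕ → Bool)} (hV : IsOpen V) (hne : V.Nonempty)
    (k : Fin 3 → Finset ℕ)
    (hA : ∀ᶠ x in residual (ℕ → Bool), x ∈ V → ∀ i, flipBy (charFun (k i)) (f x) ∈ A i)
    (u : ℕ → Bool) :
    ∃ p ∈ prodE0 (A 0) (A 1) (A 2), ∃ r, (∀ n ≥ r, turns p n = u n) ∧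
      ((∀ i, k i = ∅) → r = 0) := by
  obtain ⟨Z₀, hZ₀, hc⟩ := hfm.exists_residual_continuousOn
  set Z := {x | ∀ y, E0 x y → y ∈ Z₀ ∩
    {x | x ∈ V → ∀ i, flipBy (charFun (k i)) (f x) ∈ A i}} with hZdef
  have hZ : Z ∈ residual (ℕ → Bool) := residual_forall_E0 (inter_mem hZ₀ hA)
  have hZsub : ∀ x ∈ Z, x ∈ Z₀ ∩ {x | x ∈ V → ∀ i, flipBy (charFun (k i)) (f x) ∈ A i} :=
    fun x hx => hx x ⟨0, fun _ _ => rfl⟩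
  obtain ⟨w, ℓ, h, hℓ, hM, hhne, hsupp, himg⟩ := exists_flips_of_reduction hf hZ
    (fun x y hxy hx z hyz => hx z (hxy.trans hyz)) (hc.mono fun x hx => (hZsub x hx).1) hV hne
    (Finset.univ.sup fun i => (k i).sup id + 1)
  have hk : ∀ i m, ℓ 0 ≤ m → charFun (k i) m = false := by
    intro i m hm
    by_contra hcon
    have h1 := lt_of_charFun (by simpa using hcon : charFun (k i) m = true)
    have h2 := Finset.le_sup (f := fun i => (k i).sup id + 1) (Finset.mem_univ i)
    omega
  let v : Fin 3 → ℕ → Bool := fun i => flipBy (charFun (k i)) w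
  obtain ⟨a, r, har⟩ : ∃ a r, oddRun (v 0, v 1, v 2) (ℓ 0) = (a, r) := ⟨_, _, rfl⟩
  let c : ℕ → Fin 3 := fun n => turnFrom a (fun n => u (r + n)) (n + 1)
  have hc_ne : ∀ n, c (n + 1) ≠ c n := fun n => turnFrom_succ_ne _ _ _
  choose y hyZ hy using fun i : Fin 3 => himg fun n => decide (c n = i)
  let p : Fin 3 → ℕ → Bool := fun i => flipBy (charFun (k i)) (f (y i))
  have hpA : ∀ i, p i ∈ A i := fun i => (hZsub _ (hyZ i).1).2 (hyZ i).2 i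
  have hstem : ∀ i, ∀ m < ℓ 0, p i m = v i m := by
    intro i m hm
    simp only [p, v, hy, flipBy, flipLim, flipSum_eq_false hℓ hsupp _ (.inl hm), Bool.false_xor]
  have hblock : ∀ i n m, ℓ n ≤ m → m < ℓ (n + 1) → p i m = ((decide (c n = i) && h n m) ^^ w m) := by
    intro i n m hm hm'
    have h0 := hℓ.monotone n.zero_le
    simp only [p, hy, flipBy, hk i m (h0.trans hm), Bool.false_xor]
    rw [← flipSum_eq_flipLim hℓ hsupp _ hm', flipSum_eq hℓ hsupp _ n.lt_succ_self hm hm']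
  have hnE : ∀ i j, i ≠ j → ¬E0 (p i) (p j) := by
    rintro i j hij ⟨N, hN⟩
    obtain ⟨n, hn, hcn⟩ : ∃ n > N, c n = i ∨ c n = j := by
      have h3 : ∀ i j s t : Fin 3, i ≠ j → s ≠ t → (s = i ∨ s = j) ∨ (t = i ∨ t = j) := by decide
      rcases h3 i j _ _ hij (hc_ne (N + 1)) with h | h
      · exact ⟨N + 1 + 1, by omega, h⟩
      · exact ⟨N + 1, by omega, h⟩
    obtain ⟨m, hm⟩ := hhne n
    obtain ⟨hm1, hm2⟩ := hsupp n m hm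
    have hn' : n ≤ ℓ n := hℓ.id_le n
    have := hN m (by omega)
    rw [hblock i n m hm1 hm2, hblock j n m hm1 hm2, hm] at this
    rcases hcn with rfl | rfl
    · simp [hij] at this
    · simp [hij.symm] at this
  refine ⟨(p 0, p 1, p 2), ⟨hpA 0, hpA 1, hpA 2, hnE 0 1 (by decide), hnE 0 2 (by decide),
    hnE 1 2 (by decide)⟩, r, ?_, ?_⟩
  · intro n hn
    obtain ⟨d, rfl⟩ := Nat.exists_eq_add_of_le hn
    refine turns_eq hℓ (fun n => {m | h n m = true}) hhne hsupp (a := a) (r := r) ?_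
      (fun n => u (r + n)) (fun n j hj => ?_) d
    · rw [← har]
      exact oddRun_congr fun m hm => ⟨hstem 0 m hm, hstem 1 m hm, hstem 2 m hm⟩
    · change oddOne (p 0 j) (p 1 j) (p 2 j) = _
      rw [hblock 0 n j hj.1 hj.2, hblock 1 n j hj.1 hj.2, hblock 2 n j hj.1 hj.2]
      have h3 : ∀ (i : Fin 3) (s t : Bool), oddOne ((decide (i = 0) && s) ^^ t)
          ((decide (i = 1) && s) ^^ t) ((decide (i = 2) && s) ^^ t) =
          if s = true then some i else none := by decide
      rw [h3]
      by_cases hm : h n j = true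
      · rw [if_pos hm, if_pos (show j ∈ {m | h n m = true} from hm)]
      · rw [if_neg hm, if_neg (show j ∉ {m | h n m = true} from hm)]
  · intro hk0
    have hv : ∀ i, v i = w := fun i => by funext m; simp [v, hk0, flipBy, charFun]
    rw [hv, hv, hv, oddRun_diag] at har
    exact (congrArg Prod.snd har).symm

/-- Borel preimages of analytic sets are analytic. -/
theorem MeasureTheory.AnalyticSet.preimage_of_measurable {X Y : Type*} [TopologicalSpace X]
    [PolishSpace X] [MeasurableSpace X] [BorelSpace X] [TopologicalSpace Y] [PolishSpace Y]
    [MeasurableSpace Y] [BorelSpace Y] {g : X → Y} (hg : Measurable g) {s : Set Y}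
    (hs : MeasureTheory.AnalyticSet s) : MeasureTheory.AnalyticSet (g ⁻¹' s) := by
  have h1 : MeasureTheory.AnalyticSet {q : X × Y | g q.1 = q.2} :=
    (measurableSet_eq_fun (hg.comp measurable_fst) measurable_snd).analyticSet
  have h2 : MeasureTheory.AnalyticSet (Prod.snd ⁻¹' s : Set (X × Y)) :=
    hs.preimage continuous_snd
  have h3 : MeasureTheory.AnalyticSet ({q : X × Y | g q.1 = q.2} ∩ Prod.snd ⁻¹' s) := by
    rw [inter_eq_iInter]
    exact .iInter fun b => by cases b <;> assumption
  convert h3.image_of_continuous continuous_fst using 1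
  ext x
  constructor
  · exact fun hx => ⟨(x, g x), ⟨rfl, hx⟩, rfl⟩
  · rintro ⟨⟨x, y⟩, ⟨hxy, hy⟩, rfl⟩
    exact mem_of_eq_of_mem (s := s) (show g x = y from hxy) hy

theorem exists_flips_mem_of_subset_satE0 (hfm : Measurable f) {A : Fin 3 → Set (ℕ → Bool)}
    (hA : ∀ i, MeasureTheory.AnalyticSet (A i)) (hfA : ∀ i x, f x ∈ satE0 (A i)) :
    ∃ (V : Set (ℕ → Bool)) (k : Fin 3 → Finset ℕ), IsOpen V ∧ V.Nonempty ∧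
      ∀ᶠ x in residual (ℕ → Bool), x ∈ V → ∀ i, flipBy (charFun (k i)) (f x) ∈ A i := by
  have : PolishSpace (ℕ → Bool) :=
    @instPolishSpaceOfSeparableSpaceOfIsCompletelyMetrizableSpace _ _ inferInstance
      TopologicalSpace.IsCompletelyMetrizableSpace.pi_countable
  let T : (Fin 3 → Finset ℕ) → Set (ℕ → Bool) := fun k =>
    ⋂ i, (fun x => flipBy (charFun (k i)) (f x)) ⁻¹' A i
  have hT : ∀ k, BaireMeasurableSet (T k) := fun k => .iInter fun i =>
    ((hA i).preimage_of_measurable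
      ((continuous_flipBy _).measurable.comp hfm)).baireMeasurableSet
  choose V hV hTV using fun k => (hT k).residualEq_isOpen
  obtain ⟨k, hk⟩ : ∃ k, (V k).Nonempty := by
    by_contra! hcon
    obtain ⟨x, hx⟩ := (dense_of_mem_residual (eventually_countable_forall.2
      fun k => (hTV k).mem_iff)).nonempty
    choose z hz hzx using fun i => hfA i x
    choose k hk using fun i => (hzx i).symm.exists_flipBy
    have hxV := (hx k).1 (mem_iInter.2 fun i => by
      rw [mem_preimage, ← hk]
      exact hz i)
    rw [hcon k] at hxV
    exact hxV
  refine ⟨V k, k, hV k, hk, ?_⟩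
  filter_upwards [(hTV k).mem_iff] with x hx hxV
  exact fun i => mem_iInter.1 (hx.2 hxV) i

end Triples

/-- There is a Borel `K : (2^ω)³ → 2^ω` with `K[[A]³_{E₀}] = 2^ω` for every analytic `A` into
which `E₀` Borel-reduces, and such that for analytic `A₀, A₁, A₂` with such reductions and a
common `E₀`-saturation, the `E₀`-saturation of `K[A₀ ×_{E₀} A₁ ×_{E₀} A₂]` is all of `2^ω`. -/
theorem exists_borel_K_onto :
    ∃ K : (ℕ → Bool) × (ℕ → Bool) × (ℕ → Bool) → (ℕ → Bool), Measurable K ∧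
      (∀ A : Set (ℕ → Bool), MeasureTheory.AnalyticSet A →
        (∃ f : (ℕ → Bool) → (ℕ → Bool),
          Measurable f ∧ range f ⊆ A ∧ ∀ x y, E0 x y ↔ E0 (f x) (f y)) →
        K '' triplesE0 A = univ) ∧
      (∀ A0 A1 A2 : Set (ℕ → Bool),
        MeasureTheory.AnalyticSet A0 → MeasureTheory.AnalyticSet A1 →
        MeasureTheory.AnalyticSet A2 →
        (∃ f : (ℕ → Bool) → (ℕ → Bool),
          Measurable f ∧ range f ⊆ A0 ∧ ∀ x y, E0 x y ↔ E0 (f x) (f y)) →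
        (∃ f : (ℕ → Bool) → (ℕ → Bool),
          Measurable f ∧ range f ⊆ A1 ∧ ∀ x y, E0 x y ↔ E0 (f x) (f y)) →
        (∃ f : (ℕ → Bool) → (ℕ → Bool),
          Measurable f ∧ range f ⊆ A2 ∧ ∀ x y, E0 x y ↔ E0 (f x) (f y)) →
        satE0 A0 = satE0 A1 → satE0 A1 = satE0 A2 →
        satE0 (K '' prodE0 A0 A1 A2) = univ) := by
  refine ⟨turns, measurable_turns, ?_, ?_⟩
  · rintro A - ⟨f, hfm, hfA, hf⟩
    refine eq_univ_of_forall fun u => ?_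
    obtain ⟨p, hp, r, hr, hr0⟩ := exists_mem_prodE0_turns_eq hfm hf (A := fun _ => A) isOpen_univ
      univ_nonempty (fun _ => ∅) (.of_forall fun x _ _ => hfA ⟨x, by
        funext m
        simp [flipBy, charFun]⟩) u
    exact ⟨p, hp, funext fun n => hr n (by simp [hr0 fun _ => rfl])⟩
  · rintro A0 A1 A2 hA0 hA1 hA2 ⟨f, hfm, hfA, hf⟩ - - h01 h12
    have hfs : ∀ x, f x ∈ satE0 A0 := fun x => ⟨f x, hfA ⟨x, rfl⟩, 0, fun _ _ => rfl⟩
    obtain ⟨V, k, hV, hne, hVA⟩ := exists_flips_mem_of_subset_satE0 hfm (A := ![A0, A1, A2])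
      (by intro i; fin_cases i <;> assumption)
      (by
        intro i x
        have h0 := hfs x
        have h1 := h01 ▸ h0
        have h2 := h12 ▸ h1
        fin_cases i <;> assumption)
    refine eq_univ_of_forall fun u => ?_
    obtain ⟨p, hp, r, hr, -⟩ := exists_mem_prodE0_turns_eq hfm hf hV hne k hVA u
    exact ⟨turns p, ⟨p, hp, rfl⟩, r, fun n hn => hr n hn.le⟩
end
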